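/- If (m̃₀, m̃₁, …, m̃_d) minimizes the objective Q(m₀, m₁, …, m_d) = ∫_{ℝ^d} (m̂(x) − m₀ − Σ_{ℓ=1}^d m_ℓ(x_ℓ))² f̂(x) dx over the additive class, then for each j ∈ {1,…,d} the component m̃_j satisfies the backfitting normal equation m̃_j(x_j) = m̂_j(x_j) − m̃₀ − Σ_{ℓ≠j} ∫ m̃_ℓ(x_ℓ) f̂_{jℓ}(x_j, x_ℓ)/f̂_j(x_j) dx_ℓ for Lebesgue-almost every x_j with f̂_j(x_j) > 0 (equation (2.11) of the paper). -/

import Mathlib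

open MeasureTheory Finset

/-- Scaled kernel `K_h(u) = h⁻¹ K(u/h)`. -/
noncomputable def Kh (K : ℝ → ℝ) (h : ℝ) (u : ℝ) : ℝ := K (u / h) / h

/-- The `d`-dimensional kernel density estimator `f̂`. -/
noncomputable def fhat {N d : ℕ} (K : ℝ → ℝ) (h : ℝ) (X : Fin N → Fin d → ℝ)
    (x : Fin d → ℝ) : ℝ :=
  (1 / N : ℝ) * ∑ ℓ : Fin N, ∏ j : Fin d, Kh K h (x j - X ℓ j)

/-- The Nadaraya–Watson numerator `r̂`. -/
noncomputable def rhat {N d : ℕ} (K : ℝ → ℝ) (h : ℝ) (Y : Fin N → ℝ)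
    (X : Fin N → Fin d → ℝ) (x : Fin d → ℝ) : ℝ :=
  (1 / N : ℝ) * ∑ ℓ : Fin N, Y ℓ * ∏ j : Fin d, Kh K h (x j - X ℓ j)

/-- The Nadaraya–Watson estimator `m̂ = r̂ / f̂` (with the convention `0/0 = 0`). -/
noncomputable def mhat {N d : ℕ} (K : ℝ → ℝ) (h : ℝ) (Y : Fin N → ℝ)
    (X : Fin N → Fin d → ℝ) (x : Fin d → ℝ) : ℝ :=
  rhat K h Y X x / fhat K h X x

/-- The marginal (one-dimensional) kernel density estimator `f̂_j`. -/
noncomputable def fhatj {N d : ℕ} (K : ℝ → ℝ) (h : ℝ) (X : Fin N → Fin d → ℝ)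
    (j : Fin d) (x : ℝ) : ℝ :=
  (1 / N : ℝ) * ∑ ℓ : Fin N, Kh K h (x - X ℓ j)

/-- The marginal Nadaraya–Watson estimator `m̂_j` (with the convention `0/0 = 0`). -/
noncomputable def mhatj {N d : ℕ} (K : ℝ → ℝ) (h : ℝ) (Y : Fin N → ℝ)
    (X : Fin N → Fin d → ℝ) (j : Fin d) (x : ℝ) : ℝ :=
  ((1 / N : ℝ) * ∑ ℓ : Fin N, Y ℓ * Kh K h (x - X ℓ j)) / fhatj K h X j x

/-- The bivariate kernel density estimator `f̂_{jk}`. -/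
noncomputable def fhatjk {N d : ℕ} (K : ℝ → ℝ) (h : ℝ) (X : Fin N → Fin d → ℝ)
    (j k : Fin d) (xj xk : ℝ) : ℝ :=
  (1 / N : ℝ) * ∑ ℓ : Fin N, Kh K h (xj - X ℓ j) * Kh K h (xk - X ℓ k)

/-- The sample mean `Ȳ`. -/
noncomputable def Ybar {N : ℕ} (Y : Fin N → ℝ) : ℝ := (1 / N : ℝ) * ∑ ℓ : Fin N, Y ℓ

/-- Membership in the additive class. -/
def InAddClass {N d : ℕ} (K : ℝ → ℝ) (h : ℝ) (X : Fin N → Fin d → ℝ)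
    (m : Fin d → ℝ → ℝ) : Prop :=
  ∀ ℓ : Fin d, Measurable (m ℓ) ∧
    Integrable (fun y => (m ℓ y) ^ 2 * fhatj K h X ℓ y) ∧
    ∫ y : ℝ, m ℓ y * fhatj K h X ℓ y = 0

/-- The least-squares objective `Q(m₀, m₁, …, m_d)`. -/
noncomputable def Qobj {N d : ℕ} (K : ℝ → ℝ) (h : ℝ) (Y : Fin N → ℝ)
    (X : Fin N → Fin d → ℝ) (m0 : ℝ) (m : Fin d → ℝ → ℝ) : ℝ :=
  ∫ x : Fin d → ℝ, (mhat K h Y X x - m0 - ∑ ℓ : Fin d, m ℓ (x ℓ)) ^ 2 * fhat K h X x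

section ProductWeights

variable {d : ℕ} {w : Fin d → ℝ → ℝ}

/-- Product test functions against a product weight. -/
theorem integrable_prod_mul_prod {a : Fin d → ℝ → ℝ}
    (ha : ∀ l, Integrable (fun t => a l t * w l t)) :
    Integrable (fun x : Fin d → ℝ => (∏ l, a l (x l)) * ∏ l, w l (x l)) := by
  simp_rw [← Finset.prod_mul_distrib]
  exact Integrable.fintype_prod ha

theorem integral_prod_mul_prod (a : Fin d → ℝ → ℝ) :
    ∫ x : Fin d → ℝ, (∏ l, a l (x l)) * ∏ l, w l (x l) = ∏ l, ∫ t, a l t * w l t := by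
  simp_rw [← Finset.prod_mul_distrib]
  exact integral_fintype_prod_volume_eq_prod (fun l t => a l t * w l t)

theorem integrable_coord_mul_prod (hw : ∀ l, Integrable (w l)) (j : Fin d) {a : ℝ → ℝ}
    (ha : Integrable (fun t => a t * w j t)) :
    Integrable (fun x : Fin d → ℝ => a (x j) * ∏ l, w l (x l)) := by
  have := integrable_prod_mul_prod (w := w) (a := fun l t => if l = j then a t else 1) (by
    intro l
    by_cases hl : l = j
    · subst hl; simpa using ha
    · simpa [hl] using hw l)
  simpa using this

theorem integral_coord_mul_prod (hw1 : ∀ l, ∫ t, w l t = 1) (j : Fin d) (a : ℝ → ℝ) :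
    ∫ x : Fin d → ℝ, a (x j) * ∏ l, w l (x l) = ∫ t, a t * w j t := by
  have := integral_prod_mul_prod (w := w) (fun l t => if l = j then a t else 1)
  simp only [Finset.prod_ite_eq', Finset.mem_univ, if_true] at this
  rw [this, Finset.prod_eq_single j]
  · simp
  · intro l _ hl
    simp [hl, hw1]
  · simp

theorem integrable_coord_mul_coord_mul_prod (hw : ∀ l, Integrable (w l)) {j k : Fin d}
    (hjk : j ≠ k) {a b : ℝ → ℝ} (ha : Integrable (fun t => a t * w j t))
    (hb : Integrable (fun t => b t * w k t)) :
    Integrable (fun x : Fin d → ℝ => a (x j) * b (x k) * ∏ l, w l (x l)) := by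
  have := integrable_prod_mul_prod (w := w)
    (a := fun l t => (if l = j then a t else 1) * (if l = k then b t else 1)) (by
    intro l
    by_cases hl : l = j
    · subst hl; simpa [hjk] using ha
    · by_cases hk : l = k
      · subst hk; simpa [hl] using hb
      · simpa [hl, hk] using hw l)
  simpa only [Finset.prod_mul_distrib, Finset.prod_ite_eq', Finset.mem_univ, if_true] using this

theorem integral_coord_mul_coord_mul_prod (hw1 : ∀ l, ∫ t, w l t = 1) {j k : Fin d}
    (hjk : j ≠ k) (a b : ℝ → ℝ) :
    ∫ x : Fin d → ℝ, a (x j) * b (x k) * ∏ l, w l (x l) =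
      (∫ t, a t * w j t) * ∫ t, b t * w k t := by
  have := integral_prod_mul_prod (w := w)
    (fun l t => (if l = j then a t else 1) * (if l = k then b t else 1))
  simp only [Finset.prod_mul_distrib, Finset.prod_ite_eq', Finset.mem_univ, if_true] at this
  rw [this, Finset.prod_eq_mul j k hjk]
  · simp [hjk, hjk.symm]
  · rintro l _ ⟨hl, hk⟩
    simp [hl, hk, hw1]
  · simp
  · simp

/-- Testing an additive residual against a function of one coordinate. -/
theorem integral_coord_mul_additive_residual (hw : ∀ l, Integrable (w l))
    (hw1 : ∀ l, ∫ t, w l t = 1) {m : Fin d → ℝ → ℝ}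
    (hm : ∀ l, Integrable (fun t => m l t * w l t)) (c : ℝ) (j : Fin d) {g : ℝ → ℝ}
    (hg : Integrable (fun t => g t * w j t)) (hgm : Integrable (fun t => g t * m j t * w j t)) :
    Integrable (fun x : Fin d → ℝ => g (x j) * (c - ∑ l, m l (x l)) * ∏ l, w l (x l)) ∧
    ∫ x : Fin d → ℝ, g (x j) * (c - ∑ l, m l (x l)) * ∏ l, w l (x l) =
      ∫ t, g t * ((c - m j t - ∑ l ∈ univ.erase j, ∫ s, m l s * w l s) * w j t) := by
  have hI : ∀ l, Integrable (fun x : Fin d → ℝ => g (x j) * m l (x l) * ∏ l, w l (x l)) := by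
    intro l
    by_cases hl : j = l
    · subst hl
      exact integrable_coord_mul_prod hw j hgm
    · exact integrable_coord_mul_coord_mul_prod hw hl hg (hm l)
  have hc := (integrable_coord_mul_prod hw j hg).const_mul c
  have hS := integrable_finsetSum univ fun l _ => hI l
  have hfun : (fun x : Fin d → ℝ => g (x j) * (c - ∑ l, m l (x l)) * ∏ l, w l (x l)) =
      fun x => c * (g (x j) * ∏ l, w l (x l)) - ∑ l, g (x j) * m l (x l) * ∏ l, w l (x l) := by
    funext x
    rw [← Finset.sum_mul, ← Finset.mul_sum]
    ring
  refine ⟨hfun ▸ hc.sub hS, ?_⟩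
  rw [hfun, integral_sub hc hS, integral_finsetSum _ fun l _ => hI l, integral_const_mul,
    integral_coord_mul_prod hw1, ← Finset.add_sum_erase _ _ (mem_univ j),
    integral_coord_mul_prod hw1 j (fun t => g t * m j t)]
  have hfun' : (fun t => g t * ((c - m j t - ∑ l ∈ univ.erase j, ∫ s, m l s * w l s) * w j t)) =
      fun t => c * (g t * w j t) - (g t * m j t * w j t +
        (∑ l ∈ univ.erase j, ∫ s, m l s * w l s) * (g t * w j t)) := by
    funext t
    ring
  have hadd : Integrable (fun t => g t * m j t * w j t +
      (∑ l ∈ univ.erase j, ∫ s, m l s * w l s) * (g t * w j t)) := hgm.add (hg.const_mul _)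
  rw [hfun', integral_sub (hg.const_mul c) hadd, integral_add hgm (hg.const_mul _), integral_const_mul, integral_const_mul, Finset.sum_mul]
  congr 2
  refine Finset.sum_congr rfl fun l hl => ?_
  rw [integral_coord_mul_coord_mul_prod hw1 (Finset.ne_of_mem_erase hl).symm, mul_comm]

end ProductWeights

theorem eq_zero_of_forall_mul_le_sq_mul {b c : ℝ} (hbc : ∀ t : ℝ, 2 * t * b ≤ t ^ 2 * c) :
    b = 0 := by
  have hc : 0 ≤ c := by linarith [hbc 1, hbc (-1)]
  have h := hbc (b / (c + 1))
  have e : 2 * (b / (c + 1)) * b - (b / (c + 1)) ^ 2 * c = b ^ 2 * ((c + 2) / (c + 1) ^ 2) := by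
    field_simp
    ring
  have hpos : 0 < (c + 2) / (c + 1) ^ 2 := by positivity
  have : b ^ 2 ≤ 0 := nonpos_of_mul_nonpos_left (by linarith) hpos
  exact pow_eq_zero_iff two_ne_zero |>.1 (le_antisymm this (sq_nonneg b))

/-- First-order condition for a weighted least-squares problem along one direction. -/
theorem integral_mul_eq_zero_of_forall_integral_sq_le {α : Type*} [MeasurableSpace α]
    {μ : Measure α} {R g f : α → ℝ} (hR : Integrable (fun x => R x ^ 2 * f x) μ)
    (hRg : Integrable (fun x => g x * (R x * f x)) μ)
    (hg : Integrable (fun x => g x ^ 2 * f x) μ)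
    (hle : ∀ t : ℝ, ∫ x, R x ^ 2 * f x ∂μ ≤ ∫ x, (R x - t * g x) ^ 2 * f x ∂μ) :
    ∫ x, g x * (R x * f x) ∂μ = 0 := by
  refine eq_zero_of_forall_mul_le_sq_mul (c := ∫ x, g x ^ 2 * f x ∂μ) fun t => ?_
  have hsub : Integrable (fun x => R x ^ 2 * f x - 2 * t * (g x * (R x * f x))) μ :=
    hR.sub (hRg.const_mul _)
  have hexp : ∫ x, (R x - t * g x) ^ 2 * f x ∂μ =
      ∫ x, R x ^ 2 * f x ∂μ - 2 * t * ∫ x, g x * (R x * f x) ∂μ +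
        t ^ 2 * ∫ x, g x ^ 2 * f x ∂μ := by
    rw [← integral_const_mul, ← integral_const_mul, ← integral_sub hR (hRg.const_mul _),
      ← integral_add hsub (hg.const_mul _)]
    congr 1
    funext x
    ring
  linarith [hle t]

/-- A function that is square integrable against a finite weight is integrable against it. -/
theorem integrable_mul_of_integrable_sq_mul {α : Type*} [MeasurableSpace α] {μ : Measure α}
    {a w : α → ℝ} (ha : Measurable a) (hw : Integrable w μ) (hw0 : ∀ x, 0 ≤ w x)
    (haw : Integrable (fun x => a x ^ 2 * w x) μ) : Integrable (fun x => a x * w x) μ := by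
  refine (hw.add haw).mono' (ha.aestronglyMeasurable.mul hw.aestronglyMeasurable)
    (ae_of_all _ fun x => ?_)
  rw [Real.norm_eq_abs, abs_mul, abs_of_nonneg (hw0 x)]
  have : |a x| ≤ 1 + a x ^ 2 := by nlinarith [sq_abs (a x), sq_nonneg (|a x| - 1)]
  calc |a x| * w x ≤ (1 + a x ^ 2) * w x := mul_le_mul_of_nonneg_right this (hw0 x)
    _ = w x + a x ^ 2 * w x := by ring

section KernelEstimators

variable {N d : ℕ} {K : ℝ → ℝ} {h : ℝ} {X : Fin N → Fin d → ℝ} {Y : Fin N → ℝ}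

theorem Kh_nonneg (hKnn : ∀ u, 0 ≤ K u) (hh : 0 < h) (u : ℝ) : 0 ≤ Kh K h u :=
  div_nonneg (hKnn _) hh.le

theorem measurable_Kh (hKm : Measurable K) : Measurable (Kh K h) :=
  (hKm.comp (measurable_id.div_const h)).div_const h

theorem integrable_Kh_sub (hKi : Integrable K) (hh : 0 < h) (a : ℝ) :
    Integrable (fun t => Kh K h (t - a)) :=
  ((hKi.comp_div hh.ne').div_const h).comp_sub_right a

theorem integral_Kh_sub (hKI : ∫ u : ℝ, K u = 1) (hh : 0 < h) (a : ℝ) :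
    ∫ t, Kh K h (t - a) = 1 := by
  rw [integral_sub_right_eq_self (Kh K h) a]
  unfold Kh
  rw [integral_div, Measure.integral_comp_div, hKI, abs_of_pos hh]
  simp [hh.ne']

theorem measurable_prod_Kh (hKm : Measurable K) (i : Fin N) :
    Measurable fun x : Fin d → ℝ => ∏ l, Kh K h (x l - X i l) :=
  Finset.measurable_fun_prod _ fun l _ =>
    (measurable_Kh hKm).comp ((measurable_pi_apply l).sub_const _)

theorem measurable_fhat (hKm : Measurable K) : Measurable (fhat K h X) :=
  (Finset.measurable_fun_sum _ fun i _ => measurable_prod_Kh hKm i).const_mul _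

theorem measurable_mhat (hKm : Measurable K) : Measurable (mhat K h Y X) :=
  ((Finset.measurable_fun_sum _ fun i _ =>
    (measurable_prod_Kh hKm i).const_mul (Y i)).const_mul _).div (measurable_fhat hKm)

theorem fhat_nonneg (hKnn : ∀ u, 0 ≤ K u) (hh : 0 < h) (x : Fin d → ℝ) : 0 ≤ fhat K h X x :=
  mul_nonneg (by positivity)
    (Finset.sum_nonneg fun _ _ => Finset.prod_nonneg fun _ _ => Kh_nonneg hKnn hh _)

theorem fhatj_nonneg (hKnn : ∀ u, 0 ≤ K u) (hh : 0 < h) (j : Fin d) (t : ℝ) :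
    0 ≤ fhatj K h X j t :=
  mul_nonneg (by positivity) (Finset.sum_nonneg fun _ _ => Kh_nonneg hKnn hh _)

theorem integrable_fhatj (hKi : Integrable K) (hh : 0 < h) (j : Fin d) :
    Integrable (fhatj K h X j) :=
  (integrable_finsetSum _ fun i _ => integrable_Kh_sub hKi hh (X i j)).const_mul _

theorem integral_fhatj (hN : 0 < N) (hKi : Integrable K) (hKI : ∫ u : ℝ, K u = 1) (hh : 0 < h)
    (j : Fin d) : ∫ t, fhatj K h X j t = 1 := by
  unfold fhatj
  rw [integral_const_mul, integral_finsetSum _ fun i _ => integrable_Kh_sub hKi hh (X i j)]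
  simp [integral_Kh_sub hKI hh, hN.ne']

theorem abs_rhat_le (hKnn : ∀ u, 0 ≤ K u) (hh : 0 < h) (x : Fin d → ℝ) :
    |rhat K h Y X x| ≤ (∑ i, |Y i|) * fhat K h X x := by
  unfold rhat fhat
  have hp : ∀ i, 0 ≤ ∏ l, Kh K h (x l - X i l) := fun i =>
    Finset.prod_nonneg fun _ _ => Kh_nonneg hKnn hh _
  rw [abs_mul, abs_of_nonneg (by positivity : (0 : ℝ) ≤ 1 / N), mul_left_comm, Finset.mul_sum]
  refine mul_le_mul_of_nonneg_left ((Finset.abs_sum_le_sum_abs _ _).trans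
    (Finset.sum_le_sum fun i _ => ?_)) (by positivity)
  rw [abs_mul, abs_of_nonneg (hp i)]
  exact mul_le_mul_of_nonneg_right
    (Finset.single_le_sum (f := fun i => |Y i|) (fun _ _ => abs_nonneg _) (mem_univ i)) (hp i)

theorem mhat_mul_fhat (hKnn : ∀ u, 0 ≤ K u) (hh : 0 < h) (x : Fin d → ℝ) :
    mhat K h Y X x * fhat K h X x = rhat K h Y X x := by
  refine div_mul_cancel_of_imp fun h0 => ?_
  simpa [h0] using abs_rhat_le (Y := Y) (X := X) hKnn hh x

theorem abs_mhat_le (hKnn : ∀ u, 0 ≤ K u) (hh : 0 < h) (x : Fin d → ℝ) :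
    |mhat K h Y X x| ≤ ∑ i, |Y i| := by
  rw [mhat, abs_div, abs_of_nonneg (fhat_nonneg hKnn hh x)]
  exact div_le_of_le_mul₀ (fhat_nonneg hKnn hh x)
    (Finset.sum_nonneg fun _ _ => abs_nonneg _) (abs_rhat_le hKnn hh x)

theorem Kh_le_mul_fhatj (hKnn : ∀ u, 0 ≤ K u) (hh : 0 < h) (i : Fin N) (j : Fin d) (t : ℝ) :
    Kh K h (t - X i j) ≤ N * fhatj K h X j t := by
  have hN : (N : ℝ) ≠ 0 := Nat.cast_ne_zero.2 (Fin.pos i).ne'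
  rw [fhatj, ← mul_assoc, mul_one_div_cancel hN, one_mul]
  exact Finset.single_le_sum (f := fun i => Kh K h (t - X i j))
    (fun _ _ => Kh_nonneg hKnn hh _) (mem_univ i)

theorem integrable_mul_Kh_of_integrable_mul_fhatj (hKm : Measurable K) (hKnn : ∀ u, 0 ≤ K u)
    (hh : 0 < h) {j : Fin d} {a : ℝ → ℝ} (ha : Measurable a)
    (haf : Integrable (fun t => a t * fhatj K h X j t)) (i : Fin N) :
    Integrable (fun t => a t * Kh K h (t - X i j)) := by
  refine (haf.norm.const_mul (N : ℝ)).mono' (ha.mul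
    ((measurable_Kh hKm).comp (measurable_id.sub_const _))).aestronglyMeasurable
    (ae_of_all _ fun t => ?_)
  simp only [Real.norm_eq_abs, abs_mul, abs_of_nonneg (Kh_nonneg hKnn hh _),
    abs_of_nonneg (fhatj_nonneg hKnn hh j t)]
  calc |a t| * Kh K h (t - X i j) ≤ |a t| * (N * fhatj K h X j t) :=
        mul_le_mul_of_nonneg_left (Kh_le_mul_fhatj hKnn hh i j t) (abs_nonneg _)
    _ = N * (|a t| * fhatj K h X j t) := by ring

theorem integrable_coord_mul_fhat (hKm : Measurable K) (hKnn : ∀ u, 0 ≤ K u)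
    (hKi : Integrable K) (hh : 0 < h) {j : Fin d} {a : ℝ → ℝ} (ha : Measurable a)
    (haf : Integrable (fun t => a t * fhatj K h X j t)) :
    Integrable (fun x => a (x j) * fhat K h X x) := by
  have hs := (integrable_finsetSum univ fun i _ =>
    integrable_coord_mul_prod (w := fun l t => Kh K h (t - X i l))
      (fun _ => integrable_Kh_sub hKi hh _) j
      (integrable_mul_Kh_of_integrable_mul_fhatj hKm hKnn hh ha haf i)).const_mul (1 / N : ℝ)
  refine hs.congr (ae_of_all _ fun x => ?_)
  simp only [fhat, ← Finset.mul_sum]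
  ring

theorem integrable_fhat (hKi : Integrable K) (hh : 0 < h) : Integrable (fhat K h X) :=
  (integrable_finsetSum _ fun i _ => Integrable.fintype_prod
    (f := fun l t => Kh K h (t - X i l)) fun _ => integrable_Kh_sub hKi hh _).const_mul _

theorem integrable_residual_sq_mul_fhat (hKm : Measurable K) (hKnn : ∀ u, 0 ≤ K u)
    (hKi : Integrable K) (hh : 0 < h) (m0 : ℝ) {m : Fin d → ℝ → ℝ} (hm : InAddClass K h X m) :
    Integrable fun x => (mhat K h Y X x - m0 - ∑ l, m l (x l)) ^ 2 * fhat K h X x := by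
  set B := ∑ i, |Y i|
  have hmx : Measurable fun x : Fin d → ℝ => ∑ l, m l (x l) :=
    Finset.measurable_fun_sum _ fun l _ => (hm l).1.comp (measurable_pi_apply l)
  have hb := ((integrable_fhat (X := X) hKi hh).const_mul (2 * (B + |m0|) ^ 2)).add
    ((integrable_finsetSum univ fun l _ => integrable_coord_mul_fhat (X := X) hKm hKnn hKi hh
      ((hm l).1.pow_const 2) (hm l).2.1).const_mul (2 * d : ℝ))
  refine hb.mono' ((((measurable_mhat hKm).sub_const m0).sub hmx).pow_const 2 |>.mul
    (measurable_fhat hKm)).aestronglyMeasurable (ae_of_all _ fun x => ?_)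
  have hf := fhat_nonneg (X := X) hKnn hh x
  have h1 : (mhat K h Y X x - m0) ^ 2 ≤ (B + |m0|) ^ 2 := by
    refine sq_le_sq' ?_ ?_ <;>
      linarith [abs_le.1 (abs_mhat_le (Y := Y) (X := X) hKnn hh x), neg_abs_le m0, le_abs_self m0]
  have h2 : (∑ l, m l (x l)) ^ 2 ≤ d * ∑ l, m l (x l) ^ 2 := by
    simpa using sq_sum_le_card_mul_sum_sq (s := univ) (f := fun l => m l (x l))
  rw [Real.norm_of_nonneg (by positivity)]
  simp only [Pi.add_apply, ← Finset.sum_mul]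
  calc (mhat K h Y X x - m0 - ∑ l, m l (x l)) ^ 2 * fhat K h X x
      ≤ (2 * (B + |m0|) ^ 2 + 2 * d * ∑ l, m l (x l) ^ 2) * fhat K h X x :=
        mul_le_mul_of_nonneg_right (by
          nlinarith [sq_nonneg (mhat K h Y X x - m0 + ∑ l, m l (x l))]) hf
    _ = _ := by ring

/-- Adding a multiple of a centred bounded function to one component stays in the class. -/
theorem InAddClass.update_add_centred (hN : 0 < N) (hKnn : ∀ u, 0 ≤ K u)
    (hKi : Integrable K) (hKI : ∫ u : ℝ, K u = 1) (hh : 0 < h) {m : Fin d → ℝ → ℝ}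
    (hm : InAddClass K h X m) (j : Fin d) {g : ℝ → ℝ} (hg : Measurable g)
    (hg1 : ∀ t, |g t| ≤ 1) (s : ℝ) :
    InAddClass K h X (Function.update m j fun t =>
      m j t + s * (g t - ∫ y, g y * fhatj K h X j y)) := by
  intro l
  by_cases hl : l = j
  swap
  · rw [Function.update_of_ne hl]
    exact hm l
  subst hl
  rw [Function.update_self]
  set c := ∫ y, g y * fhatj K h X l y
  obtain ⟨hmm, hm2, hm0⟩ := hm l
  have hf := integrable_fhatj (X := X) hKi hh l
  have hf0 := fhatj_nonneg (X := X) hKnn hh l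
  have hmeas : Measurable fun t => m l t + s * (g t - c) := hmm.add ((hg.sub_const c).const_mul s)
  refine ⟨hmeas, ?_, ?_⟩
  · refine ((hm2.const_mul 2).add (hf.const_mul (2 * s ^ 2 * (1 + |c|) ^ 2))).mono'
      ((hmeas.pow_const 2).aestronglyMeasurable.mul hf.aestronglyMeasurable)
      (ae_of_all _ fun t => ?_)
    rw [Real.norm_of_nonneg (mul_nonneg (sq_nonneg _) (hf0 t))]
    have h1 : (g t - c) ^ 2 ≤ (1 + |c|) ^ 2 := by
      refine sq_le_sq' ?_ ?_ <;> linarith [abs_le.1 (hg1 t), neg_abs_le c, le_abs_self c]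
    calc (m l t + s * (g t - c)) ^ 2 * fhatj K h X l t
        ≤ (2 * m l t ^ 2 + 2 * s ^ 2 * (1 + |c|) ^ 2) * fhatj K h X l t :=
          mul_le_mul_of_nonneg_right (by
            nlinarith [sq_nonneg (m l t - s * (g t - c)),
              mul_le_mul_of_nonneg_left h1 (sq_nonneg s)]) (hf0 t)
      _ = _ := by simp only [Pi.add_apply]; ring
  · have hmf := integrable_mul_of_integrable_sq_mul hmm hf hf0 hm2
    have hgf : Integrable fun t => g t * fhatj K h X l t :=
      hf.bdd_mul hg.aestronglyMeasurable (ae_of_all _ hg1)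
    have hd : Integrable fun t => g t * fhatj K h X l t - c * fhatj K h X l t :=
      hgf.sub (hf.const_mul c)
    calc ∫ y, (m l y + s * (g y - c)) * fhatj K h X l y
        = ∫ y, m l y * fhatj K h X l y +
            s * (g y * fhatj K h X l y - c * fhatj K h X l y) := by
          congr 1; funext y; ring
      _ = 0 := by
          rw [integral_add hmf (hd.const_mul s), integral_const_mul,
            integral_sub hgf (hf.const_mul c), integral_const_mul, hm0,
            integral_fhatj hN hKi hKI hh]
          simp [c]

/-- The residual of a minimizer is orthogonal to bounded functions of a single coordinate. -/
theorem integral_coord_mul_residual_eq_zero (hN : 0 < N) (hKm : Measurable K)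
    (hKnn : ∀ u, 0 ≤ K u) (hKi : Integrable K) (hKI : ∫ u : ℝ, K u = 1) (hh : 0 < h) {m0 : ℝ}
    {m : Fin d → ℝ → ℝ} (hm : InAddClass K h X m)
    (hmin : ∀ (m0' : ℝ) (m' : Fin d → ℝ → ℝ), InAddClass K h X m' →
      Qobj K h Y X m0 m ≤ Qobj K h Y X m0' m')
    (j : Fin d) {g : ℝ → ℝ} (hg : Measurable g) (hg1 : ∀ t, |g t| ≤ 1) :
    ∫ x : Fin d → ℝ,
      g (x j) * ((mhat K h Y X x - m0 - ∑ l, m l (x l)) * fhat K h X x) = 0 := by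
  have hf := integrable_fhat (X := X) hKi hh
  have hgx : AEStronglyMeasurable (fun x : Fin d → ℝ => g (x j)) volume :=
    (hg.comp (measurable_pi_apply j)).aestronglyMeasurable
  have hR2 := integrable_residual_sq_mul_fhat (Y := Y) hKm hKnn hKi hh m0 hm
  have hR := integrable_mul_of_integrable_sq_mul
    (((measurable_mhat hKm).sub_const m0).sub (Finset.measurable_fun_sum _ fun l _ =>
      (hm l).1.comp (measurable_pi_apply l))) hf (fhat_nonneg hKnn hh) hR2
  refine integral_mul_eq_zero_of_forall_integral_sq_le (g := fun x : Fin d → ℝ => g (x j)) hR2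
    (hR.bdd_mul hgx (ae_of_all _ fun x => hg1 (x j)))
    (hf.bdd_mul (c := 1) (hgx.pow 2) (ae_of_all _ fun x => ?_)) fun s => ?_
  · simpa using hg1 (x j)
  · refine (hmin (m0 + s * ∫ y, g y * fhatj K h X j y) _
      (hm.update_add_centred hN hKnn hKi hKI hh j hg hg1 s)).trans_eq ?_
    unfold Qobj
    congr 1
    funext x
    rw [← Finset.add_sum_erase _ _ (mem_univ j), ← Finset.add_sum_erase _ _ (mem_univ j),
      Function.update_self, Finset.sum_congr rfl fun l hl => by
        rw [Function.update_of_ne (Finset.ne_of_mem_erase hl)]]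
    ring

theorem residual_mul_fhat (hKnn : ∀ u, 0 ≤ K u) (hh : 0 < h) (m0 : ℝ) (m : Fin d → ℝ → ℝ)
    (x : Fin d → ℝ) :
    (mhat K h Y X x - m0 - ∑ l, m l (x l)) * fhat K h X x =
      (1 / N : ℝ) * ∑ i, (Y i - m0 - ∑ l, m l (x l)) * ∏ l, Kh K h (x l - X i l) := by
  rw [sub_mul, sub_mul, mhat_mul_fhat hKnn hh]
  simp only [rhat, fhat, sub_mul, Finset.sum_sub_distrib, ← Finset.mul_sum]
  ring

end KernelEstimators

/-- any minimizer of the least-squares objective over the additive class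
satisfies the backfitting normal equations (2.11), for a.e. point where `f̂_j > 0`. -/
theorem minimizer_satisfies_backfitting_normal_equation
    {N d : ℕ} (hN : 0 < N) (K : ℝ → ℝ) (hKm : Measurable K)
    (hKb : ∃ C, ∀ u, K u ≤ C) (hKnn : ∀ u, 0 ≤ K u) (hKI : ∫ u : ℝ, K u = 1)
    (h : ℝ) (hh : 0 < h) (Y : Fin N → ℝ) (X : Fin N → Fin d → ℝ)
    (m0 : ℝ) (m : Fin d → ℝ → ℝ) (hm : InAddClass K h X m)
    (hmin : ∀ (m0' : ℝ) (m' : Fin d → ℝ → ℝ), InAddClass K h X m' →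
      Qobj K h Y X m0 m ≤ Qobj K h Y X m0' m') :
    ∀ j : Fin d, ∀ᵐ xj : ℝ, 0 < fhatj K h X j xj →
      m j xj = mhatj K h Y X j xj - m0 -
        ∑ ℓ ∈ Finset.univ.erase j,
          ∫ t : ℝ, m ℓ t * (fhatjk K h X j ℓ xj t / fhatj K h X j xj) := by
  intro j
  have hKi : Integrable K := by
    by_contra hK
    simp [integral_undef hK] at hKI
  have hw : ∀ i l, Integrable fun t => Kh K h (t - X i l) := fun i l => integrable_Kh_sub hKi hh _
  have hmw : ∀ i l, Integrable fun t => m l t * Kh K h (t - X i l) := fun i l =>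
    integrable_mul_Kh_of_integrable_mul_fhatj hKm hKnn hh (hm l).1
      (integrable_mul_of_integrable_sq_mul (hm l).1 (integrable_fhatj hKi hh l)
        (fhatj_nonneg hKnn hh l) (hm l).2.1) i
  set C : Fin N → ℝ := fun i => ∑ l ∈ univ.erase j, ∫ s, m l s * Kh K h (s - X i l)
  set H : Fin N → ℝ → ℝ := fun i t => (Y i - m0 - m j t - C i) * Kh K h (t - X i j)
  have hH : ∀ i, Integrable (H i) := fun i => by
    refine (((hw i j).const_mul (Y i - m0 - C i)).sub (hmw i j)).congr (ae_of_all _ fun t => ?_)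
    simp only [Pi.sub_apply, H]
    ring
  have hzero : (fun t => ∑ i, H i t) =ᵐ[volume] 0 := by
    refine (integrable_finsetSum _ fun i _ => hH i).ae_eq_zero_of_forall_setIntegral_eq_zero
      fun s hs _ => ?_
    set g : ℝ → ℝ := s.indicator 1
    have hg : Measurable g := measurable_one.indicator hs
    have hg1 : ∀ t, |g t| ≤ 1 := fun t => by
      by_cases ht : t ∈ s <;> simp [g, ht]
    have hbdd : ∀ {a : ℝ → ℝ}, Integrable a → Integrable fun t => g t * a t := fun ha =>
      ha.bdd_mul hg.aestronglyMeasurable (ae_of_all _ hg1)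
    have key := fun i => integral_coord_mul_additive_residual
      (w := fun l t => Kh K h (t - X i l)) (hw i) (fun _ => integral_Kh_sub hKI hh _) (hmw i)
      (Y i - m0) j (hbdd (hw i j)) (by simpa only [mul_assoc] using hbdd (hmw i j))
    have horth := integral_coord_mul_residual_eq_zero hN hKm hKnn hKi hKI hh hm hmin j hg hg1
    simp only [residual_mul_fhat hKnn hh, mul_left_comm (g _) (1 / N : ℝ), Finset.mul_sum,
      ← mul_assoc (g _)] at horth
    simp only [← Finset.mul_sum] at horth
    rw [integral_const_mul, integral_finsetSum _ fun i _ => (key i).1] at horth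
    rw [integral_finsetSum _ fun i _ => (hH i).integrableOn]
    have hN' : (1 / N : ℝ) ≠ 0 := by positivity
    rw [← (mul_eq_zero.1 horth).resolve_left hN']
    refine Finset.sum_congr rfl fun i _ => ?_
    rw [(key i).2, ← integral_indicator hs]
    congr 1
    funext t
    by_cases ht : t ∈ s <;> simp [g, ht, H, C]
  filter_upwards [hzero] with t ht hpos
  have hint : ∀ l, ∫ s, m l s * (fhatjk K h X j l t s / fhatj K h X j t) =
      ((1 / N : ℝ) * ∑ i, Kh K h (t - X i j) * ∫ s, m l s * Kh K h (s - X i l)) /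
        fhatj K h X j t := fun l => by
    simp only [← integral_const_mul]
    rw [← integral_finsetSum _ fun i _ => (hmw i l).const_mul _, ← integral_const_mul,
      ← integral_div]
    congr 1
    funext s
    rw [fhatjk, ← mul_div_assoc, mul_left_comm, Finset.mul_sum]
    simp only [mul_left_comm]
  simp only [hint]
  rw [← Finset.sum_div, ← Finset.mul_sum, Finset.sum_comm, mhatj, eq_sub_iff_add_eq,
    eq_sub_iff_add_eq, eq_div_iff hpos.ne', add_mul, add_mul, div_mul_cancel₀ _ hpos.ne']
  have hsum : ∑ i, Y i * Kh K h (t - X i j) = m j t * ∑ i, Kh K h (t - X i j) +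
      ∑ i, Kh K h (t - X i j) * C i + m0 * ∑ i, Kh K h (t - X i j) := by
    rw [← sub_eq_zero, Finset.mul_sum, Finset.mul_sum, ← Finset.sum_add_distrib,
      ← Finset.sum_add_distrib, ← Finset.sum_sub_distrib]
    refine Eq.trans (Finset.sum_congr rfl fun i _ => ?_) ht
    simp only [H]
    ring
  rw [hsum]
  simp only [fhatj, C, ← Finset.mul_sum]
  ring
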